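/- Let c be a real number with ν₃ < c ≤ √15/2, where ν₃ = √( 5/2 + (5/18)(25/18)^{1/3}·( (27 − 7√21)^{1/3} + (27 + 7√21)^{1/3} ) ), and let q_c(u,v) = −(1/35)(5u³ + 6u²v + 8uv² + 16v³) − (c/315)(35u⁴ + 40u³v + 48u²v² + 64uv³ + 128v⁴) − (1/693)(63u⁵ + 70u⁴v + 80u³v² + 96u²v³ + 128uv⁴ + 256v⁵). Then there exist t > 0, u ∈ ℝ and two distinct points v < u and w < u, v ≠ w, such that, writing P(z) := 6t + ∂_v q_c(u,z) + ∂_u q_c(u,z), both z = v and z = w satisfy P(z) = 0, P'(z) = 0 and P''(z) < 0. That is, for these values of c the solution of the Whitham equations possesses a double trailing edge. -/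

import Mathlib

/-- The polynomial q_c(u,v) of equation (4.6). -/
noncomputable def qc (c u v : ℝ) : ℝ :=
  -(1 / 35) * (5 * u ^ 3 + 6 * u ^ 2 * v + 8 * u * v ^ 2 + 16 * v ^ 3) -
    c / 315 * (35 * u ^ 4 + 40 * u ^ 3 * v + 48 * u ^ 2 * v ^ 2 + 64 * u * v ^ 3 +
      128 * v ^ 4) -
    1 / 693 * (63 * u ^ 5 + 70 * u ^ 4 * v + 80 * u ^ 3 * v ^ 2 + 96 * u ^ 2 * v ^ 3 +
      128 * u * v ^ 4 + 256 * v ^ 5)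

/-- The trailing-edge polynomial P(z) = 6t + ∂_v q_c(u,z) + ∂_u q_c(u,z). -/
noncomputable def Ptrail (c t u : ℝ) : ℝ → ℝ := fun z =>
  6 * t + deriv (fun b => qc c u b) z + deriv (fun a => qc c a z) u

/-- The leading-edge polynomial L(z) = 2t + ∂_u q_c(u,z). -/
noncomputable def Llead (c t u : ℝ) : ℝ → ℝ := fun z =>
  2 * t + deriv (fun a => qc c a z) u

/-- The real cube root. -/
noncomputable def cbrt (x : ℝ) : ℝ :=
  if x < 0 then -((-x) ^ ((1 : ℝ) / 3)) else x ^ ((1 : ℝ) / 3)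

/-- ν₃ = √(5/2 + (5/18)(25/18)^{1/3}((27 − 7√21)^{1/3} + (27 + 7√21)^{1/3})). -/
noncomputable def nu3 : ℝ :=
  Real.sqrt (5 / 2 + 5 / 18 * (25 / 18 : ℝ) ^ ((1 : ℝ) / 3) *
    (cbrt (27 - 7 * Real.sqrt 21) + cbrt (27 + 7 * Real.sqrt 21)))

theorem hasDerivAt_quintic (a₀ a₁ a₂ a₃ a₄ a₅ x : ℝ) :
    HasDerivAt (fun y : ℝ => a₀ + a₁ * y + a₂ * y ^ 2 + a₃ * y ^ 3 + a₄ * y ^ 4 + a₅ * y ^ 5)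
      (a₁ + 2 * a₂ * x + 3 * a₃ * x ^ 2 + 4 * a₄ * x ^ 3 + 5 * a₅ * x ^ 4) x := by
  have h := (((((hasDerivAt_const x a₀).add ((hasDerivAt_id x).const_mul a₁)).add
    ((hasDerivAt_pow 2 x).const_mul a₂)).add ((hasDerivAt_pow 3 x).const_mul a₃)).add
    ((hasDerivAt_pow 4 x).const_mul a₄)).add ((hasDerivAt_pow 5 x).const_mul a₅)
  refine h.congr_deriv ?_
  norm_num
  ring

theorem deriv_eq_of_eq_quintic {f : ℝ → ℝ} (a₀ a₁ a₂ a₃ a₄ a₅ : ℝ)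
    (hf : ∀ y, f y = a₀ + a₁ * y + a₂ * y ^ 2 + a₃ * y ^ 3 + a₄ * y ^ 4 + a₅ * y ^ 5) (x : ℝ) :
    deriv f x = a₁ + 2 * a₂ * x + 3 * a₃ * x ^ 2 + 4 * a₄ * x ^ 3 + 5 * a₅ * x ^ 4 := by
  rw [funext hf]
  exact (hasDerivAt_quintic a₀ a₁ a₂ a₃ a₄ a₅ x).deriv

/-- The expanded form of `Ptrail`. -/
theorem Ptrail_eq (c t u z : ℝ) :
    Ptrail c t u z = 6 * t - 128 / 63 * (z ^ 4 + (u / 2 + 9 * c / 10) * z ^ 3 +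
      (63 / 80 + 3 / 8 * u ^ 2 + 9 / 20 * c * u) * z ^ 2 +
      (63 / 160 * u + 5 / 16 * u ^ 3 + 27 / 80 * c * u ^ 2) * z +
      (189 / 640 * u ^ 2 + 35 / 128 * u ^ 4 + 9 / 32 * c * u ^ 3)) := by
  unfold Ptrail
  rw [deriv_eq_of_eq_quintic (f := fun b => qc c u b)
      (-(1 / 7) * u ^ 3 - c / 9 * u ^ 4 - 1 / 11 * u ^ 5)
      (-(6 / 35) * u ^ 2 - c * 40 / 315 * u ^ 3 - 70 / 693 * u ^ 4)
      (-(8 / 35) * u - c * 48 / 315 * u ^ 2 - 80 / 693 * u ^ 3)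
      (-(16 / 35) - c * 64 / 315 * u - 96 / 693 * u ^ 2)
      (-(c * 128 / 315) - 128 / 693 * u) (-(256 / 693)) (fun y => by unfold qc; ring),
    deriv_eq_of_eq_quintic (f := fun a => qc c a z)
      (-(16 / 35) * z ^ 3 - c * 128 / 315 * z ^ 4 - 256 / 693 * z ^ 5)
      (-(8 / 35) * z ^ 2 - c * 64 / 315 * z ^ 3 - 128 / 693 * z ^ 4)
      (-(6 / 35) * z - c * 48 / 315 * z ^ 2 - 96 / 693 * z ^ 3)
      (-(1 / 7) - c * 40 / 315 * z - 80 / 693 * z ^ 2)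
      (-(c * 35 / 315) - 70 / 693 * z) (-(63 / 693)) (fun y => by unfold qc; ring)]
  ring

/-- A negative multiple of the square of a quadratic vanishes with negative second derivative at
each simple root of the quadratic. -/
theorem isMax_of_eq_neg_sq {f : ℝ → ℝ} {A b d : ℝ} (hA : A < 0)
    (hf : ∀ z, f z = A * (z ^ 2 + b * z + d) ^ 2) {v : ℝ} (hv : v ^ 2 + b * v + d = 0)
    (hs : 2 * v + b ≠ 0) : f v = 0 ∧ deriv f v = 0 ∧ deriv (deriv f) v < 0 := by
  have h1 : ∀ z, deriv f z = 2 * A * (2 * z + b) * (z ^ 2 + b * z + d) := by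
    intro z
    rw [deriv_eq_of_eq_quintic (A * d ^ 2) (A * (2 * b * d)) (A * (b ^ 2 + 2 * d)) (A * (2 * b)) A 0
      (fun y => by rw [hf]; ring)]
    ring
  have h2 : deriv (deriv f) v = 2 * A * ((2 * v + b) ^ 2 + 2 * (v ^ 2 + b * v + d)) := by
    rw [deriv_eq_of_eq_quintic (2 * A * (b * d)) (2 * A * (b ^ 2 + 2 * d)) (2 * A * (3 * b))
      (2 * A * 2) 0 0 (fun y => by rw [h1]; ring)]
    ring
  refine ⟨by rw [hf, hv]; ring, by rw [h1, hv]; ring, ?_⟩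
  rw [h2, hv]
  have : 0 < (2 * v + b) ^ 2 := by positivity
  nlinarith

theorem cbrt_pow_three (x : ℝ) : cbrt x ^ 3 = x := by
  have key : ∀ y : ℝ, 0 ≤ y → (y ^ ((1 : ℝ) / 3)) ^ 3 = y := by
    intro y hy
    rw [← Real.rpow_natCast, ← Real.rpow_mul hy]
    norm_num
  unfold cbrt
  split_ifs with h
  · rw [neg_pow, key _ (by linarith)]
    ring
  · exact key x (by linarith)

/-- Cardano's formula for the real root of `243 m³ + 1875 m = 3125`. -/
theorem cardano_root :
    let m := 5 / 9 * (25 / 18 : ℝ) ^ ((1 : ℝ) / 3) *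
      (cbrt (27 - 7 * Real.sqrt 21) + cbrt (27 + 7 * Real.sqrt 21))
    243 * m ^ 3 + 1875 * m = 3125 := by
  intro m
  have hg : (25 / 18 : ℝ) ^ ((1 : ℝ) / 3) = cbrt (25 / 18) := by
    unfold cbrt
    rw [if_neg (by norm_num)]
  have hm : m = 5 / 9 * cbrt (25 / 18) *
      (cbrt (27 - 7 * Real.sqrt 21) + cbrt (27 + 7 * Real.sqrt 21)) := by rw [← hg]
  rw [hm]
  have h1 := cbrt_pow_three (27 - 7 * Real.sqrt 21)
  have h2 := cbrt_pow_three (27 + 7 * Real.sqrt 21)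
  have h3 := cbrt_pow_three (25 / 18)
  generalize cbrt (27 - 7 * Real.sqrt 21) = p at *
  generalize cbrt (27 + 7 * Real.sqrt 21) = q at *
  generalize cbrt (25 / 18) = g at *
  have h21 : Real.sqrt 21 ^ 2 = 21 := Real.sq_sqrt (by norm_num)
  have hpq : p * q = -6 * g := by
    apply (Odd.strictMono_pow (R := ℝ) (n := 3) (by decide)).injective
    change (p * q) ^ 3 = (-6 * g) ^ 3
    rw [mul_pow, mul_pow, h1, h2, h3]
    linear_combination -49 * h21
  linear_combination (243 * 125 / 729 * (p + q) ^ 3) * h3 +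
    (243 * 125 / 729 * (25 / 18)) * (h1 + h2 + 3 * (p + q) * hpq)

/-- Strict monotonicity of the Cardano cubic places `2 c² - 5` beyond its root. -/
theorem cubic_pos_of_nu3_lt {c : ℝ} (hc : nu3 < c) :
    3125 < 243 * (2 * c ^ 2 - 5) ^ 3 + 1875 * (2 * c ^ 2 - 5) := by
  have h0 : 0 < c := lt_of_le_of_lt (Real.sqrt_nonneg _) hc
  have hlt := (Real.sqrt_lt' h0).1 hc
  have hm := cardano_root
  dsimp only at hm
  rw [← hm]
  have hlt' : 5 / 9 * (25 / 18 : ℝ) ^ ((1 : ℝ) / 3) *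
      (cbrt (27 - 7 * Real.sqrt 21) + cbrt (27 + 7 * Real.sqrt 21)) < 2 * c ^ 2 - 5 := by
    linarith
  have := (Odd.strictMono_pow (R := ℝ) (n := 3) (by decide)) hlt'
  dsimp only at this
  linarith

/-- Existence of a root, in the rescaled variable `r = 5u/3`, of the resolvent cubic at which the
quadratic factor of the trailing-edge quartic has positive discriminant. -/
theorem exists_resolvent_root {c : ℝ} (h0 : 0 < c) (hc : 4 * c ^ 2 ≤ 15)
    (hm : 3125 < 243 * (2 * c ^ 2 - 5) ^ 3 + 1875 * (2 * c ^ 2 - 5)) :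
    ∃ r : ℝ, 0 < r ∧
      15 * r ^ 3 + 15 * c * r ^ 2 + (35 - 9 * c ^ 2) * r - 3 * c * (35 - 9 * c ^ 2) = 0 ∧
      0 < 27 * c ^ 2 - 6 * c * r - 9 * r ^ 2 - 70 := by
  have hm1 : 1 < 2 * c ^ 2 - 5 := by
    by_contra! h
    nlinarith [(Odd.strictMono_pow (R := ℝ) (n := 3) (by decide)).monotone h]
  set s := Real.sqrt (28 * c ^ 2 - 70) with hs
  have hs2 : s ^ 2 = 28 * c ^ 2 - 70 := Real.sq_sqrt (by linarith)
  have hs0 : 0 ≤ s := Real.sqrt_nonneg _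
  have hcs : c < s := by
    apply lt_of_pow_lt_pow_left₀ 2 hs0
    linarith
  have hs3 : 20 * c * (15 - 4 * c ^ 2) < s ^ 3 := by
    apply lt_of_pow_lt_pow_left₀ 2 (by positivity)
    have : (s ^ 3) ^ 2 = (28 * c ^ 2 - 70) ^ 3 := by rw [← hs2]; ring
    rw [this]
    nlinarith
  let f : ℝ → ℝ := fun r =>
    15 * r ^ 3 + 15 * c * r ^ 2 + (35 - 9 * c ^ 2) * r - 3 * c * (35 - 9 * c ^ 2)
  have hf0 : f 0 < 0 := by
    simp only [f]
    nlinarith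
  have hf1 : 0 < f ((s - c) / 3) := by
    have : 9 * f ((s - c) / 3) = 7 / 2 * (s ^ 3 - 20 * c * (15 - 4 * c ^ 2)) := by
      simp only [f]
      linear_combination (3 / 2 * s) * hs2
    linarith
  obtain ⟨r, ⟨hr0, hr1⟩, hr⟩ := intermediate_value_Ioo (f := f) (a := 0) (b := (s - c) / 3)
    (by linarith) (by fun_prop) ⟨hf0, hf1⟩
  refine ⟨r, hr0, hr, ?_⟩
  have : (3 * r + c) ^ 2 < s ^ 2 := by
    apply pow_lt_pow_left₀ <;> linarith
  nlinarith

/-- The constant term of the completed square is negative at the resolvent root. -/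
theorem const_neg_of_resolvent {c r k : ℝ} (hc : 0 < c) (hr : 0 < r) (hk : 0 < k)
    (h : k * (3 * c - r) = 15 * r ^ 2 * (r + c)) (hd : 2 * k < 9 * c ^ 2 - 6 * c * r - 9 * r ^ 2) :
    k ^ 2 + 12 * c * r * k - 14 * k * r ^ 2 - 180 * c ^ 2 * r ^ 2 - 255 * r ^ 4 - 420 * c * r ^ 3
      < 0 := by
  have hrc : r < 3 / 4 * c := by
    by_contra! hle
    nlinarith
  have hcr : 0 < c * r := by positivity
  have hk1 : k ≤ 12 * r ^ 2 := by
    have h1 : 0 < 3 * c - r := by linarith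
    refine le_of_mul_le_mul_right ?_ h1
    rw [h]
    nlinarith [sq_nonneg r, mul_nonneg (sq_nonneg r) (by linarith : 0 ≤ 3 / 4 * c - r)]
  have hk2 : k + 12 * c * r ≤ 12 * c ^ 2 := by nlinarith
  have h3 : k * (k + 12 * c * r) ≤ 12 * r ^ 2 * (12 * c ^ 2) :=
    mul_le_mul hk1 hk2 (by nlinarith) (by positivity)
  have h4 : 0 < c ^ 2 * r ^ 2 := by positivity
  have h5 : 0 < k * r ^ 2 := by positivity
  have h6 : 0 < c * r ^ 3 := by positivity
  have h7 : 0 < r ^ 4 := by positivity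
  nlinarith

/-- For ν₃ < c ≤ √15/2 the Whitham solution possesses a double trailing edge: there are
    t > 0, u and two distinct points v < u, w < u that are simultaneously zeros and local
    maxima of the quartic P(z) = 6t + ∂_v q_c(u,z) + ∂_u q_c(u,z). -/
theorem stmt12 (c : ℝ) (hc1 : nu3 < c) (hc2 : c ≤ Real.sqrt 15 / 2) :
    ∃ t u v w : ℝ, 0 < t ∧ v < u ∧ w < u ∧ v ≠ w ∧
      Ptrail c t u v = 0 ∧ deriv (Ptrail c t u) v = 0 ∧ deriv (deriv (Ptrail c t u)) v < 0 ∧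
      Ptrail c t u w = 0 ∧ deriv (Ptrail c t u) w = 0 ∧
      deriv (deriv (Ptrail c t u)) w < 0 := by
  have h0 : 0 < c := lt_of_le_of_lt (Real.sqrt_nonneg _) hc1
  have hc15 : 4 * c ^ 2 ≤ 15 := by
    have h15 : Real.sqrt 15 ^ 2 = 15 := Real.sq_sqrt (by norm_num)
    nlinarith [Real.sqrt_nonneg 15]
  obtain ⟨r, hr0, hr, hd⟩ := exists_resolvent_root h0 hc15 (cubic_pos_of_nu3_lt hc1)
  have hT := const_neg_of_resolvent h0 hr0 (k := 35 - 9 * c ^ 2) (by linarith)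
    (by linear_combination -hr) (by linarith)
  set b : ℝ := 3 / 20 * r + 9 / 20 * c with hb
  set d : ℝ := 63 / 160 + 9 / 160 * r ^ 2 + 27 / 400 * c * r - 81 / 800 * c ^ 2 with hdd
  set T : ℝ := 81 / 640000 * ((35 - 9 * c ^ 2) ^ 2 + 12 * c * r * (35 - 9 * c ^ 2)
    - 14 * (35 - 9 * c ^ 2) * r ^ 2 - 180 * c ^ 2 * r ^ 2 - 255 * r ^ 4 - 420 * c * r ^ 3) with hTT
  have hP : ∀ z, Ptrail c (-(64 / 189) * T) (3 / 5 * r) z =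
      -(128 / 63) * (z ^ 2 + b * z + d) ^ 2 := by
    intro z
    rw [Ptrail_eq, hTT, hb, hdd]
    linear_combination (-(128 / 63) * 27 / 8000 * z) * hr
  have hdisc : 0 < b ^ 2 - 4 * d := by
    rw [hb, hdd]
    nlinarith
  set s := Real.sqrt (b ^ 2 - 4 * d) with hs
  have hs2 : s ^ 2 = b ^ 2 - 4 * d := Real.sq_sqrt hdisc.le
  have hs0 : 0 < s := Real.sqrt_pos.2 hdisc
  have hsu : s < 6 / 5 * r + b := by
    apply lt_of_pow_lt_pow_left₀ 2 (by positivity)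
    rw [hs2, hb, hdd]
    have : 0 < c * r := by positivity
    nlinarith [sq_nonneg r]
  obtain ⟨hv1, hv2, hv3⟩ := isMax_of_eq_neg_sq (by norm_num) hP (v := (-b + s) / 2)
    (by linear_combination hs2 / 4) (by ring_nf; exact hs0.ne')
  obtain ⟨hw1, hw2, hw3⟩ := isMax_of_eq_neg_sq (by norm_num) hP (v := (-b - s) / 2)
    (by linear_combination hs2 / 4) (by ring_nf; exact (neg_neg_of_pos hs0).ne)
  refine ⟨-(64 / 189) * T, 3 / 5 * r, (-b + s) / 2, (-b - s) / 2, ?_, ?_, ?_, ?_,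
    hv1, hv2, hv3, hw1, hw2, hw3⟩ <;> linarith
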